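/- Fix strings Y and Z. For all 1 ≤ y ≤ |Y| and 1 ≤ z ≤ |Z|, if D2[y−1,z−1] > 0 then D2[y,z] ≥ D2[y−1,z−1] + 1. Consequently, the table defined by the recurrence for D2 augmented with the additional selectable option 'D2[y−1,z−1] + 1, selectable only if D2[y−1,z−1] > 0' coincides with D2. -/

import Mathlib

/-- Length of a longest common subsequence of `Y[1..y]` and `Z[1..z]`
(lists model strings; `List.Sublist` models subsequences). -/
noncomputable def lcs2 {α : Type*} (A B : List α) : ℕ :=
  sSup {n : ℕ | ∃ U : List α, U.Sublist A ∧ U.Sublist B ∧ U.length = n}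

/-- The table `D2` of Section 3: `D2[y,0] = D2[0,z] = 0` and, for `y,z ≥ 1`,
`D2[y,z]` is the maximum of `2·LCS(y−1,z)+1` (selectable only if `LCS(y−1,z−1) > 0`),
`D2[y−1,z]+1` (selectable only if `D2[y−1,z] > 0`), `D2[y,z−1]`, and `0`. -/
noncomputable def D2 {α : Type*} (Y Z : List α) : ℕ → ℕ → ℕ
  | 0, _ => 0
  | _ + 1, 0 => 0
  | y + 1, z + 1 =>
      max (max
        (if 0 < lcs2 (Y.take y) (Z.take z) then 2 * lcs2 (Y.take y) (Z.take (z + 1)) + 1 else 0)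
        (if 0 < D2 Y Z y (z + 1) then D2 Y Z y (z + 1) + 1 else 0))
        (D2 Y Z (y + 1) z)
  termination_by y z => (y, z)

/-- The table `D2'`: the recurrence of `D2` augmented with the additional selectable
option `D2'[y−1,z−1] + 1`, selectable only if `D2'[y−1,z−1] > 0`. -/
noncomputable def D2' {α : Type*} (Y Z : List α) : ℕ → ℕ → ℕ
  | 0, _ => 0
  | _ + 1, 0 => 0
  | y + 1, z + 1 =>
      max (max (max
        (if 0 < lcs2 (Y.take y) (Z.take z) then 2 * lcs2 (Y.take y) (Z.take (z + 1)) + 1 else 0)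
        (if 0 < D2' Y Z y (z + 1) then D2' Y Z y (z + 1) + 1 else 0))
        (D2' Y Z (y + 1) z))
        (if 0 < D2' Y Z y z then D2' Y Z y z + 1 else 0)
  termination_by y z => (y, z)

theorem D2_le_succ_right {α : Type*} (Y Z : List α) (y z : ℕ) :
    D2 Y Z y z ≤ D2 Y Z y (z + 1) := by
  cases y with
  | zero => simp [D2]
  | succ y =>
    rw [D2.eq_3 Y Z y z]
    exact le_max_right _ _

theorem D2_succ_le_succ_succ {α : Type*} (Y Z : List α) (y z : ℕ) (h : 0 < D2 Y Z y z) :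
    D2 Y Z y z + 1 ≤ D2 Y Z (y + 1) (z + 1) := by
  have hle := D2_le_succ_right Y Z y z
  rw [D2.eq_3 Y Z y z, if_pos (h.trans_le hle)]
  exact (Nat.succ_le_succ hle).trans ((le_max_right _ _).trans (le_max_left _ _))

theorem D2'_eq_D2 {α : Type*} (Y Z : List α) : ∀ y z : ℕ, D2' Y Z y z = D2 Y Z y z
  | 0, _ => by simp [D2, D2']
  | _ + 1, 0 => by simp [D2, D2']
  | y + 1, z + 1 => by
    rw [D2'.eq_3 Y Z y z, D2'_eq_D2 Y Z y (z + 1), D2'_eq_D2 Y Z (y + 1) z, D2'_eq_D2 Y Z y z,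
      ← D2.eq_3 Y Z y z]
    refine max_eq_left ?_
    split_ifs with h
    · exact D2_succ_le_succ_succ Y Z y z h
    · exact Nat.zero_le _
  termination_by y z => (y, z)

/-- For all `1 ≤ y ≤ |Y|` and `1 ≤ z ≤ |Z|`, if `D2[y−1,z−1] > 0` then
`D2[y,z] ≥ D2[y−1,z−1] + 1`; consequently, the augmented table `D2'` coincides
with `D2` on its whole domain. -/
theorem d2_diagonal_option_redundant {α : Type*} [DecidableEq α] (Y Z : List α) :
    (∀ y z : ℕ, 1 ≤ y → y ≤ Y.length → 1 ≤ z → z ≤ Z.length →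
      0 < D2 Y Z (y - 1) (z - 1) → D2 Y Z (y - 1) (z - 1) + 1 ≤ D2 Y Z y z) ∧
    (∀ y z : ℕ, y ≤ Y.length → z ≤ Z.length → D2' Y Z y z = D2 Y Z y z) := by
  refine ⟨fun y z hy _ hz _ h => ?_, fun y z _ _ => D2'_eq_D2 Y Z y z⟩
  obtain ⟨y, rfl⟩ := Nat.exists_eq_add_of_le' hy
  obtain ⟨z, rfl⟩ := Nat.exists_eq_add_of_le' hz
  exact D2_succ_le_succ_succ Y Z y z h
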